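/- Let n ≥ 2 and let F be a Finsler metric on a nonempty open set U ⊆ ℝⁿ which is weak Einstein: its Ricci curvature satisfies Ric(x,y) = (n−1)(3ξ(x,y)/F(x,y) + μ(x)) F(x,y)² for a smooth 1-form ξ = ξ_i(x)y^i and a smooth function μ on U. Then F is of weakly isotropic scalar curvature; precisely, its Akbar-Zadeh scalar curvature satisfies r(x,y) = n(n−1)(θ(x,y)/F(x,y) + μ(x)) with θ = (3(n+1)/(2n)) ξ. -/

import Mathlib

open MeasureTheory Matrix

noncomputable section

/-- `Vec n` is ℝⁿ. -/
abbrev Vec (n : ℕ) := Fin n → ℝ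

/-- Partial derivative of `f` in the `i`-th coordinate direction at `x`. -/
noncomputable def pd {n : ℕ} (i : Fin n) (f : Vec n → ℝ) (x : Vec n) : ℝ :=
  fderiv ℝ f x (Pi.single i 1)

/-- Partial derivative in the `i`-th `y`-coordinate of a function of `(x, y)`. -/
noncomputable def dy {n : ℕ} (i : Fin n) (f : Vec n → Vec n → ℝ) (x y : Vec n) : ℝ :=
  pd i (f x) y

/-- Partial derivative in the `i`-th `x`-coordinate of a function of `(x, y)`. -/
noncomputable def dx {n : ℕ} (i : Fin n) (f : Vec n → Vec n → ℝ) (x y : Vec n) : ℝ :=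
  pd i (fun x' => f x' y) x

/-- The square `F²` of a metric function. -/
noncomputable def F2 {n : ℕ} (F : Vec n → Vec n → ℝ) : Vec n → Vec n → ℝ :=
  fun x y => (F x y) ^ 2

/-- The fundamental tensor `g_{ij}(x,y) = ½ ∂²(F²)/∂yⁱ∂yʲ`. -/
noncomputable def gmat {n : ℕ} (F : Vec n → Vec n → ℝ) (x y : Vec n) :
    Matrix (Fin n) (Fin n) ℝ :=
  Matrix.of fun i j => (1 / 2) * dy i (fun x' y' => dy j (F2 F) x' y') x y

/-- The inverse fundamental tensor `(g^{ij})`. -/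
noncomputable def ginv {n : ℕ} (F : Vec n → Vec n → ℝ) (x y : Vec n) :
    Matrix (Fin n) (Fin n) ℝ :=
  (gmat F x y)⁻¹

/-- The geodesic coefficients
`Gⁱ = ¼ g^{il} (∂²(F²)/∂x^m∂y^l · y^m − ∂(F²)/∂x^l)`. -/
noncomputable def Geo {n : ℕ} (F : Vec n → Vec n → ℝ) (i : Fin n) (x y : Vec n) : ℝ :=
  (1 / 4) * ∑ l, ginv F x y i l *
    ((∑ m, dx m (fun x' y' => dy l (F2 F) x' y') x y * y m) - dx l (F2 F) x y)

/-- The Riemann curvature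
`Rⁱ_k = 2 ∂Gⁱ/∂x^k − ∂²Gⁱ/∂x^j∂y^k y^j + 2 G^j ∂²Gⁱ/∂y^j∂y^k − ∂Gⁱ/∂y^j ∂G^j/∂y^k`. -/
noncomputable def Riem {n : ℕ} (F : Vec n → Vec n → ℝ) (i k : Fin n) (x y : Vec n) : ℝ :=
  2 * dx k (Geo F i) x y
    - (∑ j, dy k (fun x' y' => dx j (Geo F i) x' y') x y * y j)
    + 2 * ∑ j, Geo F j x y * dy j (fun x' y' => dy k (Geo F i) x' y') x y
    - ∑ j, dy j (Geo F i) x y * dy k (Geo F j) x y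

/-- The Ricci curvature `Ric = R^m_m`. -/
noncomputable def RicciC {n : ℕ} (F : Vec n → Vec n → ℝ) (x y : Vec n) : ℝ :=
  ∑ m, Riem F m m x y

/-- The Ricci curvature tensor `Ric_{ij} = ½ ∂²Ric/∂yⁱ∂yʲ`. -/
noncomputable def RicciTensor {n : ℕ} (F : Vec n → Vec n → ℝ) (i j : Fin n)
    (x y : Vec n) : ℝ :=
  (1 / 2) * dy i (fun x' y' => dy j (RicciC F) x' y') x y

/-- The Akbar-Zadeh scalar curvature `r = g^{ij} Ric_{ij}`. -/
noncomputable def scalarCurv {n : ℕ} (F : Vec n → Vec n → ℝ) (x y : Vec n) : ℝ :=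
  ∑ i, ∑ j, ginv F x y i j * RicciTensor F i j x y

/-- The Busemann-Hausdorff volume coefficient
`σ_BH(x) = Vol(𝔹ⁿ) / Vol {y | F(x,y) < 1}`. -/
noncomputable def sigmaBH {n : ℕ} (F : Vec n → Vec n → ℝ) (x : Vec n) : ℝ :=
  (volume {y : Vec n | ∑ i, (y i) ^ 2 < 1}).toReal /
    (volume {y : Vec n | F x y < 1}).toReal

/-- The S-curvature `S(x,y) = ∂G^m/∂y^m − y^m ∂/∂x^m (ln σ_BH)`. -/
noncomputable def SCurv {n : ℕ} (F : Vec n → Vec n → ℝ) (x y : Vec n) : ℝ :=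
  (∑ m, dy m (Geo F m) x y) - ∑ m, y m * pd m (fun x' => Real.log (sigmaBH F x')) x

/-- `F` is a Finsler metric on the open set `U ⊆ ℝⁿ`: it is smooth and positive on
`U × (ℝⁿ \ {0})`, positively 1-homogeneous in `y`, and its fundamental tensor is
positive definite. -/
def IsFinslerOn {n : ℕ} (F : Vec n → Vec n → ℝ) (U : Set (Vec n)) : Prop :=
  ContDiffOn ℝ (⊤ : ℕ∞) (fun p : Vec n × Vec n => F p.1 p.2)
    (U ×ˢ {y : Vec n | y ≠ 0}) ∧
  ∀ x ∈ U, ∀ y : Vec n, y ≠ 0 →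
    0 < F x y ∧ (∀ t : ℝ, 0 < t → F x (t • y) = t * F x y) ∧ (gmat F x y).PosDef

/-- The Riemannian part `α(x,y) = √(a_{ij}(x) yⁱ yʲ)` of a Randers metric. -/
noncomputable def ralpha {n : ℕ} (a : Vec n → Matrix (Fin n) (Fin n) ℝ)
    (x y : Vec n) : ℝ :=
  Real.sqrt (∑ i, ∑ j, a x i j * y i * y j)

/-- The 1-form part `β(x,y) = b_i(x) yⁱ` of a Randers metric. -/
noncomputable def rbeta {n : ℕ} (b : Vec n → Vec n) (x y : Vec n) : ℝ :=
  ∑ i, b x i * y i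

/-- `b(x)² = a^{ij}(x) b_i(x) b_j(x)`, the square of the α-norm of β. -/
noncomputable def bnormsq {n : ℕ} (a : Vec n → Matrix (Fin n) (Fin n) ℝ)
    (b : Vec n → Vec n) (x : Vec n) : ℝ :=
  ∑ i, ∑ j, (a x)⁻¹ i j * b x i * b x j

/-- The data `(a, b)` defines a Randers metric `F = α + β` on `U`:
`a` is a smooth field of symmetric positive definite matrices, `b` is a smooth
field of covectors with `‖β‖_α < 1`, and `F = α + β` is a Finsler metric on `U`. -/
def IsRandersOn {n : ℕ} (a : Vec n → Matrix (Fin n) (Fin n) ℝ) (b : Vec n → Vec n)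
    (U : Set (Vec n)) : Prop :=
  (∀ i j, ContDiffOn ℝ (⊤ : ℕ∞) (fun x => a x i j) U) ∧
  ContDiffOn ℝ (⊤ : ℕ∞) b U ∧
  (∀ x ∈ U, (a x).IsSymm ∧ (a x).PosDef ∧ bnormsq a b x < 1) ∧
  IsFinslerOn (fun x y => ralpha a x y + rbeta b x y) U

lemma pd_mul' {n : ℕ} (i : Fin n) {f g : Vec n → ℝ} {y : Vec n}
    (hf : DifferentiableAt ℝ f y) (hg : DifferentiableAt ℝ g y) :
    pd i (fun z => f z * g z) y = pd i f y * g y + f y * pd i g y := by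
  unfold pd
  rw [fderiv_fun_mul hf hg]
  simp
  ring

lemma pd_add' {n : ℕ} (i : Fin n) {f g : Vec n → ℝ} {y : Vec n}
    (hf : DifferentiableAt ℝ f y) (hg : DifferentiableAt ℝ g y) :
    pd i (fun z => f z + g z) y = pd i f y + pd i g y := by
  unfold pd
  rw [fderiv_fun_add hf hg]
  simp

lemma pd_const_mul' {n : ℕ} (i : Fin n) {f : Vec n → ℝ} {y : Vec n} (c : ℝ)
    (hf : DifferentiableAt ℝ f y) :
    pd i (fun z => c * f z) y = c * pd i f y := by
  unfold pd
  rw [fderiv_const_mul hf]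
  simp

lemma pd_sum' {n : ℕ} (i : Fin n) {f : Fin n → Vec n → ℝ} {y : Vec n}
    (hf : ∀ j, DifferentiableAt ℝ (f j) y) :
    pd i (fun z => ∑ j, f j z) y = ∑ j, pd i (f j) y := by
  unfold pd
  rw [fderiv_fun_sum (fun j _ => hf j)]
  simp

lemma pd_coord {n : ℕ} (i j : Fin n) (y : Vec n) :
    pd i (fun z : Vec n => z j) y = if j = i then 1 else 0 := by
  unfold pd
  have h : HasFDerivAt (fun z : Vec n => z j)
      (ContinuousLinearMap.proj (R := ℝ) (φ := fun _ : Fin n => ℝ) j) y := hasFDerivAt_apply j y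
  rw [h.fderiv]
  simp [Pi.single_apply]

lemma pd_lin {n : ℕ} (i : Fin n) (c : Vec n) (y : Vec n) :
    pd i (fun z : Vec n => ∑ j, c j * z j) y = c i := by
  rw [pd_sum' i (fun j => by fun_prop)]
  have : ∀ j, pd i (fun z : Vec n => c j * z j) y = c j * (if j = i then 1 else 0) := by
    intro j
    rw [pd_const_mul' i (c j) (by fun_prop), pd_coord]
  simp [this]

lemma pd_congr' {n : ℕ} (i : Fin n) {f g : Vec n → ℝ} {y : Vec n} (hy : y ≠ 0)
    (h : ∀ z : Vec n, z ≠ 0 → f z = g z) : pd i f y = pd i g y := by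
  unfold pd
  have : f =ᶠ[nhds y] g := by
    filter_upwards [isOpen_ne.mem_nhds hy] with z hz using h z hz
  rw [this.fderiv_eq]

lemma pd_diff {n : ℕ} (j : Fin n) {f : Vec n → ℝ}
    (hf : ContDiffOn ℝ (⊤ : ℕ∞) f {y : Vec n | y ≠ 0}) {y : Vec n} (hy : y ≠ 0) :
    DifferentiableAt ℝ (pd j f) y := by
  have h1 : ContDiffOn ℝ 1 (fderiv ℝ f) {y : Vec n | y ≠ 0} :=
    hf.fderiv_of_isOpen isOpen_ne (by norm_cast)
  have h2 : DifferentiableAt ℝ (fderiv ℝ f) y :=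
    (h1.differentiableOn (by simp)).differentiableAt (isOpen_ne.mem_nhds hy)
  unfold pd
  exact h2.clm_apply (differentiableAt_const _)

lemma euler1 {n : ℕ} {f : Vec n → ℝ} {y : Vec n} (hf : DifferentiableAt ℝ f y)
    (hom : ∀ t : ℝ, 0 < t → f (t • y) = t * f y) : ∑ j, y j * pd j f y = f y := by
  have e : ∑ j, y j * pd j f y = fderiv ℝ f y y := by
    have : ∀ L : Vec n →L[ℝ] ℝ, ∑ j, y j * L (Pi.single j 1) = L y := by
      intro L
      conv_rhs => rw [pi_eq_sum_univ' y]
      simp only [map_sum, map_smul, smul_eq_mul]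
    exact this _
  rw [e]
  have h1 : HasDerivAt (fun t : ℝ => t • y) y 1 := by
    simpa using (hasDerivAt_id (1:ℝ)).smul_const y
  have h2 : HasDerivAt (fun t : ℝ => f (t • y)) (fderiv ℝ f y y) 1 := by
    have hf' : HasFDerivAt f (fderiv ℝ f y) ((1:ℝ) • y) := by
      rw [one_smul]; exact hf.hasFDerivAt
    exact hf'.comp_hasDerivAt (1:ℝ) h1
  have h3 : HasDerivAt (fun t : ℝ => t * f y) (f y) 1 := by
    simpa using (hasDerivAt_id (1:ℝ)).mul_const (f y)
  have h4 : (fun t : ℝ => f (t • y)) =ᶠ[nhds 1] fun t : ℝ => t * f y := by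
    filter_upwards [lt_mem_nhds (zero_lt_one : (0:ℝ) < 1)] with t ht using hom t ht
  exact h2.unique (h3.congr_of_eventuallyEq h4)

lemma pd_pd_mul {n : ℕ} (i j : Fin n) {f g : Vec n → ℝ}
    (hf : ContDiffOn ℝ (⊤ : ℕ∞) f {y : Vec n | y ≠ 0})
    (hg : ContDiffOn ℝ (⊤ : ℕ∞) g {y : Vec n | y ≠ 0}) {y : Vec n} (hy : y ≠ 0) :
    pd i (fun z => pd j (fun w => f w * g w) z) y =
      pd i (pd j f) y * g y + pd j f y * pd i g y
        + (pd i f y * pd j g y + f y * pd i (pd j g) y) := by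
  have df : ∀ z : Vec n, z ≠ 0 → DifferentiableAt ℝ f z := fun z hz =>
    (hf.differentiableOn (by simp)).differentiableAt (isOpen_ne.mem_nhds hz)
  have dg : ∀ z : Vec n, z ≠ 0 → DifferentiableAt ℝ g z := fun z hz =>
    (hg.differentiableOn (by simp)).differentiableAt (isOpen_ne.mem_nhds hz)
  rw [pd_congr' i hy (fun z hz => pd_mul' j (df z hz) (dg z hz)),
    pd_add' i ((pd_diff j hf hy).fun_mul (dg y hy)) ((df y hy).fun_mul (pd_diff j hg hy)),
    pd_mul' i (pd_diff j hf hy) (dg y hy), pd_mul' i (df y hy) (pd_diff j hg hy)]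

lemma pd_pd_lin {n : ℕ} (i j : Fin n) (c y : Vec n) :
    pd i (pd j (fun z : Vec n => ∑ j, c j * z j)) y = 0 := by
  have : pd j (fun z : Vec n => ∑ j, c j * z j) = fun _ => c j := by
    funext z; exact pd_lin j c z
  rw [this]
  simp [pd]

lemma alg {n : ℕ} (g : Matrix (Fin n) (Fin n) ℝ) (hg : g.PosDef) (f μ : ℝ) (hf : 0 < f)
    (y p ξ : Vec n) (H : Fin n → Fin n → ℝ)
    (h1 : ∑ j, y j * p j = f) (h2 : ∀ i, ∑ j, y j * H i j = 0)
    (h3 : ∀ i j, g i j = p i * p j + f * H i j) :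
    ∑ i, ∑ j, g⁻¹ i j * (3 / 2 * (ξ i * p j + ξ j * p i + (∑ k, ξ k * y k) * H i j) + μ * g i j)
      = 3 / 2 * (n + 1) * (∑ k, ξ k * y k) / f + n * μ := by
  have hf' := hf.ne'
  have hdet : IsUnit g.det := (Matrix.isUnit_iff_isUnit_det _).1 hg.isUnit
  have hgy : g *ᵥ y = f • p := by
    funext i
    simp only [Matrix.mulVec, dotProduct, Pi.smul_apply, smul_eq_mul]
    calc ∑ j, g i j * y j = p i * (∑ j, y j * p j) + f * ∑ j, y j * H i j := by
          rw [Finset.mul_sum, Finset.mul_sum, ← Finset.sum_add_distrib]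
          exact Finset.sum_congr rfl fun j _ => by rw [h3]; ring
      _ = f * p i := by rw [h1, h2]; ring
  have hyp : y = f • (g⁻¹ *ᵥ p) := by
    rw [← Matrix.mulVec_smul, ← hgy, Matrix.mulVec_mulVec, Matrix.nonsing_inv_mul _ hdet,
      Matrix.one_mulVec]
  have hip : ∀ i, ∑ j, g⁻¹ i j * p j = y i / f := by
    intro i
    have := congrFun hyp i
    simp only [Matrix.mulVec, dotProduct, Pi.smul_apply, smul_eq_mul] at this
    rw [this]; field_simp
  have hsg : ∀ i j, g i j = g j i := fun i j => by simpa using (hg.isHermitian.apply i j).symm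
  have hs : ∀ i j, g⁻¹ i j = g⁻¹ j i := fun i j => by
    simpa using (hg.isHermitian.inv.apply i j).symm
  have htr : ∑ i, ∑ j, g⁻¹ i j * g i j = n := by
    have : ∀ i, ∑ j, g⁻¹ i j * g i j = 1 := by
      intro i
      have := congrFun (congrFun (Matrix.nonsing_inv_mul g hdet) i) i
      rw [Matrix.mul_apply, Matrix.one_apply_eq] at this
      rw [← this]
      exact Finset.sum_congr rfl fun j _ => by rw [hsg i j]
    simp [this]
  have t1 : ∀ a : Vec n, ∑ i, ∑ j, g⁻¹ i j * (a i * p j) = (∑ i, a i * y i) / f := by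
    intro a
    rw [Finset.sum_div]
    refine Finset.sum_congr rfl fun i _ => ?_
    rw [mul_div_assoc, ← hip, Finset.mul_sum]
    exact Finset.sum_congr rfl fun j _ => by ring
  have t2 : ∑ i, ∑ j, g⁻¹ i j * (ξ j * p i) = (∑ i, ξ i * y i) / f := by
    rw [← t1 ξ, Finset.sum_comm]
    exact Finset.sum_congr rfl fun i _ => Finset.sum_congr rfl fun j _ => by rw [hs]
  have t3 : ∑ i, ∑ j, g⁻¹ i j * (p i * p j) = 1 := by
    rw [t1 p, ← h1, div_eq_one_iff_eq (by rw [h1]; exact hf')]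
    exact Finset.sum_congr rfl fun i _ => by ring
  set S := ∑ k, ξ k * y k with hS
  have key : ∀ i j, g⁻¹ i j * (3 / 2 * (ξ i * p j + ξ j * p i + S * H i j) + μ * g i j)
      = 3 / 2 * (g⁻¹ i j * (ξ i * p j)) + 3 / 2 * (g⁻¹ i j * (ξ j * p i))
        + (3 / 2 * S / f + μ) * (g⁻¹ i j * g i j)
        + (- (3 / 2 * S / f)) * (g⁻¹ i j * (p i * p j)) := by
    intro i j
    rw [h3 i j]; field_simp; ring
  simp only [key, Finset.sum_add_distrib, ← Finset.mul_sum]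
  rw [t1, t2, t3, htr]
  field_simp; ring

/-- **Lemma 2.1.** A weak Einstein Finsler metric, with
`Ric = (n−1)(3ξ/F + μ)F²`, is of weakly isotropic scalar curvature:
`r = n(n−1)(θ/F + μ)` with `θ = (3(n+1)/(2n)) ξ`. -/
theorem weak_einstein_implies_weakly_isotropic_scalar_curvature
    {n : ℕ} (hn : 2 ≤ n)
    (U : Set (Vec n)) (hUopen : IsOpen U) (hUne : U.Nonempty)
    (F : Vec n → Vec n → ℝ) (hF : IsFinslerOn F U)
    (ξ : Vec n → Vec n) (μ : Vec n → ℝ)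
    (hξ : ContDiffOn ℝ (⊤ : ℕ∞) ξ U) (hμ : ContDiffOn ℝ (⊤ : ℕ∞) μ U)
    (hweakEinstein : ∀ x ∈ U, ∀ y : Vec n, y ≠ 0 →
      RicciC F x y =
        ((n : ℝ) - 1) * (3 * (∑ i, ξ x i * y i) / F x y + μ x) * (F x y) ^ 2) :
    ∀ x ∈ U, ∀ y : Vec n, y ≠ 0 →
      scalarCurv F x y =
        (n : ℝ) * ((n : ℝ) - 1) *
          ((3 * ((n : ℝ) + 1) / (2 * (n : ℝ))) * (∑ i, ξ x i * y i) / F x y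
            + μ x) := by
  intro x hx y hy
  obtain ⟨hsm, hfin⟩ := hF
  have hn0 : (n : ℝ) ≠ 0 := by positivity
  have hf : ContDiffOn ℝ (⊤ : ℕ∞) (F x) {y : Vec n | y ≠ 0} := by
    have hc : ContDiffOn ℝ (⊤ : ℕ∞) (fun y : Vec n => (x, y)) {y : Vec n | y ≠ 0} :=
      (contDiff_prodMk_right x).contDiffOn
    exact hsm.comp hc (fun z hz => ⟨hx, hz⟩)
  have df : ∀ z : Vec n, z ≠ 0 → DifferentiableAt ℝ (F x) z := fun z hz =>
    (hf.differentiableOn (by simp)).differentiableAt (isOpen_ne.mem_nhds hz)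
  obtain ⟨hpos, hhom, hpd⟩ := hfin x hx y hy
  have h1 : ∑ j, y j * pd j (F x) y = F x y := euler1 (df y hy) hhom
  have h2 : ∀ i, ∑ j, y j * pd i (pd j (F x)) y = 0 := by
    intro i
    have e : pd i (fun z => ∑ j, z j * pd j (F x) z) y = pd i (F x) y :=
      pd_congr' i hy fun z hz => euler1 (df z hz) (hfin x hx z hz).2.1
    have dc : ∀ j, DifferentiableAt ℝ (fun z : Vec n => z j) y := fun j => by fun_prop
    rw [pd_sum' i (fun j => (dc j).fun_mul (pd_diff j hf hy))] at e
    simp only [pd_mul' i (dc _) (pd_diff _ hf hy), pd_coord, Finset.sum_add_distrib] at e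
    simpa using e
  have h3 : ∀ i j, gmat F x y i j
      = pd i (F x) y * pd j (F x) y + F x y * pd i (pd j (F x)) y := by
    intro i j
    have : (F2 F) x = fun w => F x w * F x w := by funext w; simp [F2, sq]
    simp only [gmat, Matrix.of_apply, dy, this]
    rw [pd_pd_mul i j hf hf hy]; ring
  have hlin : ContDiffOn ℝ (⊤ : ℕ∞) (fun z : Vec n => ∑ k, ξ x k * z k) {y : Vec n | y ≠ 0} :=
    ContDiff.contDiffOn (by fun_prop)
  have hlin3 : ContDiffOn ℝ (⊤ : ℕ∞)
      (fun z : Vec n => ∑ k, (((n:ℝ) - 1) * 3 * ξ x k) * z k) {y : Vec n | y ≠ 0} :=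
    ContDiff.contDiffOn (by fun_prop)
  set c : Vec n := fun k => ((n:ℝ) - 1) * 3 * ξ x k with hc
  set G : Vec n → ℝ := fun z => (∑ k, c k * z k) + (((n:ℝ) - 1) * μ x) * F x z with hG
  have hGs : ContDiffOn ℝ (⊤ : ℕ∞) G {y : Vec n | y ≠ 0} :=
    hlin3.add (contDiffOn_const.mul hf)
  have hR : ∀ z : Vec n, z ≠ 0 → RicciC F x z = G z * F x z := by
    intro z hz
    have hp := (hfin x hx z hz).1.ne'
    rw [hweakEinstein x hx z hz]
    have : ∑ k, c k * z k = ((n:ℝ) - 1) * 3 * ∑ k, ξ x k * z k := by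
      rw [Finset.mul_sum]; exact Finset.sum_congr rfl fun k _ => by simp only [hc]; ring
    simp only [hG, this]
    field_simp
  have dl : ∀ z : Vec n, DifferentiableAt ℝ (fun z : Vec n => ∑ k, c k * z k) z :=
    fun z => by fun_prop
  have pG : ∀ j, ∀ z : Vec n, z ≠ 0 →
      pd j G z = c j + (((n:ℝ) - 1) * μ x) * pd j (F x) z := by
    intro j z hz
    rw [hG, pd_add' j (dl z) ((df z hz).const_mul _), pd_lin, pd_const_mul' j _ (df z hz)]
  have ppG : ∀ i j, pd i (pd j G) y = (((n:ℝ) - 1) * μ x) * pd i (pd j (F x)) y := by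
    intro i j
    rw [pd_congr' i hy (pG j), pd_add' i (differentiableAt_const _)
      ((pd_diff j hf hy).const_mul _), pd_const_mul' i _ (pd_diff j hf hy)]
    simp [pd]
  have hT : ∀ i j, RicciTensor F i j x y = ((n:ℝ) - 1) *
      (3 / 2 * (ξ x i * pd j (F x) y + ξ x j * pd i (F x) y
        + (∑ k, ξ x k * y k) * pd i (pd j (F x)) y) + μ x * gmat F x y i j) := by
    intro i j
    simp only [RicciTensor, dy]
    rw [pd_congr' i hy (fun z hz => pd_congr' j hz hR), pd_pd_mul i j hGs hf hy, ppG,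
      pG i y hy, pG j y hy, h3]
    have : ∑ k, c k * y k = ((n:ℝ) - 1) * 3 * ∑ k, ξ x k * y k := by
      rw [Finset.mul_sum]; exact Finset.sum_congr rfl fun k _ => by simp only [hc]; ring
    simp only [hG, this]
    simp only [hc]
    ring
  have A := alg (gmat F x y) hpd (F x y) (μ x) hpos y (fun j => pd j (F x) y) (ξ x)
    (fun i j => pd i (pd j (F x)) y) h1 h2 h3
  have : scalarCurv F x y = ((n:ℝ) - 1) * (3 / 2 * (n + 1) * (∑ k, ξ x k * y k) / F x y
      + n * μ x) := by
    rw [← A]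
    simp only [scalarCurv, ginv, hT, Finset.mul_sum]
    exact Finset.sum_congr rfl fun i _ => Finset.sum_congr rfl fun j _ => by ring
  rw [this]
  have hp := hpos.ne'
  field_simp
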